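/- (Tightness of the randomized Kaczmarz bound.) Let A be a nonzero real m×n matrix each of whose rows is nonzero, and suppose all nonzero singular values of A are equal, i.e. there is σ > 0 with AAᵀA = σ²A. Let b ∈ range(A), x⁰ ∈ ℝⁿ arbitrary, and let x* be the unique vector with Ax* = b and x⁰ − x* ∈ range(Aᵀ). Then for every k ≥ 1 the randomized Kaczmarz iterates satisfy E[‖x^k − x*‖₂²] = ρ^k ‖x⁰ − x*‖₂² exactly, where ρ = 1 − σ²/‖A‖_F². -/

import Mathlib

open Matrix

/-- Squared Euclidean norm. -/
def sqnorm {n : ℕ} (u : Fin n → ℝ) : ℝ := ∑ i, (u i) ^ 2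

/-- Squared Frobenius norm of a matrix. -/
def frob2 {m n : ℕ} (A : Matrix (Fin m) (Fin n) ℝ) : ℝ := ∑ i, ∑ j, (A i j) ^ 2

/-- Squared Euclidean norm of the `i`-th row of `A`. -/
def rowNorm2 {m n : ℕ} (A : Matrix (Fin m) (Fin n) ℝ) (i : Fin m) : ℝ := ∑ j, (A i j) ^ 2

/-- One Kaczmarz step for the system `Ax = b`, using row `i`. -/
noncomputable def kacStep {m n : ℕ} (A : Matrix (Fin m) (Fin n) ℝ) (b : Fin m → ℝ) (i : Fin m)
    (x : Fin n → ℝ) : Fin n → ℝ :=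
  x - ((A.mulVec x i - b i) / rowNorm2 A i) • (fun j => A i j)

theorem sqnorm_eq_dotProduct {n : ℕ} (u : Fin n → ℝ) : sqnorm u = u ⬝ᵥ u := by
  simp [sqnorm, dotProduct, sq]

theorem rowNorm2_eq_dotProduct {m n : ℕ} (A : Matrix (Fin m) (Fin n) ℝ) (i : Fin m) :
    rowNorm2 A i = (fun j => A i j) ⬝ᵥ (fun j => A i j) := by
  simp [rowNorm2, dotProduct, sq]

theorem rowNorm2_ne_zero {m n : ℕ} {A : Matrix (Fin m) (Fin n) ℝ} {i : Fin m}
    (h : (fun j => A i j) ≠ 0) : rowNorm2 A i ≠ 0 := by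
  rw [rowNorm2_eq_dotProduct]
  simpa using h

theorem frob2_ne_zero {m n : ℕ} {A : Matrix (Fin m) (Fin n) ℝ} (hA : A ≠ 0) :
    frob2 A ≠ 0 := by
  contrapose! hA
  ext i j
  have h := (Finset.sum_eq_zero_iff_of_nonneg
    fun i _ => Finset.sum_nonneg fun j _ => sq_nonneg (A i j)).1 hA i (Finset.mem_univ i)
  have hT := (Finset.sum_eq_zero_iff_of_nonneg fun j _ => sq_nonneg (A i j)).1 h j
    (Finset.mem_univ j)
  simpa using hT

/-- On the row space of `A`, where `AAᵀA = cA`, the map `A` scales squared norms by `c`. -/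
theorem sqnorm_mulVec_of_mem_range_transpose {m n : ℕ} {A : Matrix (Fin m) (Fin n) ℝ} {c : ℝ}
    (h : A * Aᵀ * A = c • A) {e : Fin n → ℝ} (he : e ∈ Set.range (Aᵀ.mulVec)) :
    sqnorm (A.mulVec e) = c * sqnorm e := by
  obtain ⟨y, rfl⟩ := he
  have hT : Aᵀ * (A * Aᵀ) = c • Aᵀ := by
    simpa [Matrix.transpose_mul] using congrArg Matrix.transpose h
  simp only [sqnorm_eq_dotProduct]
  rw [Matrix.dotProduct_mulVec, ← Matrix.mulVec_transpose, Matrix.mulVec_mulVec,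
    Matrix.mulVec_mulVec, Matrix.mul_assoc, hT, Matrix.smul_mulVec, smul_dotProduct, smul_eq_mul]

theorem kacStep_sub_mem_range_transpose {m n : ℕ} (A : Matrix (Fin m) (Fin n) ℝ)
    (b : Fin m → ℝ) (i : Fin m) {x xs : Fin n → ℝ} (hx : x - xs ∈ Set.range (Aᵀ.mulVec)) :
    kacStep A b i x - xs ∈ Set.range (Aᵀ.mulVec) := by
  obtain ⟨y, hy⟩ := hx
  refine ⟨y - Pi.single i ((A.mulVec x i - b i) / rowNorm2 A i), ?_⟩
  simp only [Matrix.mulVec_sub, hy, Matrix.mulVec_single]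
  ext j
  simp [kacStep]
  ring

/-- A Kaczmarz step removes the component of the error along the chosen row. -/
theorem rowNorm2_mul_sqnorm_kacStep_sub {m n : ℕ} {A : Matrix (Fin m) (Fin n) ℝ} {i : Fin m}
    (hi : (fun j => A i j) ≠ 0) {b : Fin m → ℝ} {xs : Fin n → ℝ} (hxs : A.mulVec xs = b)
    (x : Fin n → ℝ) :
    rowNorm2 A i * sqnorm (kacStep A b i x - xs)
      = rowNorm2 A i * sqnorm (x - xs) - (A.mulVec (x - xs) i) ^ 2 := by
  have hr := rowNorm2_ne_zero hi
  have hd : (fun j => A i j) ⬝ᵥ (x - xs) = A.mulVec (x - xs) i := rfl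
  have hstep : kacStep A b i x - xs
      = (x - xs) - (A.mulVec (x - xs) i / rowNorm2 A i) • (fun j => A i j) := by
    rw [kacStep, ← hxs, Matrix.mulVec_sub, Pi.sub_apply]
    abel
  rw [hstep]
  clear hstep
  generalize x - xs = e at *
  simp only [sqnorm_eq_dotProduct, sub_dotProduct, dotProduct_sub, smul_dotProduct, dotProduct_smul,
    smul_eq_mul, dotProduct_comm e (fun j => A i j), hd, ← rowNorm2_eq_dotProduct]
  field_simp
  ring

/-- The expected squared error after one randomized Kaczmarz step. -/
theorem sum_sqnorm_kacStep_sub {m n : ℕ} {A : Matrix (Fin m) (Fin n) ℝ} (hA : A ≠ 0)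
    (hrows : ∀ i, (fun j => A i j) ≠ 0) {b : Fin m → ℝ} {xs : Fin n → ℝ}
    (hxs : A.mulVec xs = b) (x : Fin n → ℝ) :
    ∑ i, rowNorm2 A i / frob2 A * sqnorm (kacStep A b i x - xs)
      = sqnorm (x - xs) - sqnorm (A.mulVec (x - xs)) / frob2 A := by
  have hF := frob2_ne_zero hA
  have hsum : ∑ i, rowNorm2 A i = frob2 A := rfl
  simp_rw [div_mul_eq_mul_div, rowNorm2_mul_sqnorm_kacStep_sub (hrows _) hxs]
  rw [← Finset.sum_div, Finset.sum_sub_distrib, ← Finset.sum_mul, hsum, sub_div,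
    mul_div_cancel_left₀ _ hF]
  rfl

/-- Tightness of the randomized Kaczmarz bound: if all nonzero singular values of `A` are
equal (`AAᵀA = σ²A` with `σ > 0`), then `E[‖x^k − x*‖₂²] = ρ^k ‖x⁰ − x*‖₂²` exactly,
where `ρ = 1 − σ²/‖A‖_F²`. -/
theorem stmt7 {m n : ℕ} (A : Matrix (Fin m) (Fin n) ℝ) (hA : A ≠ 0)
    (hrows : ∀ i, (fun j => A i j) ≠ 0)
    (σ : ℝ) (hσ : 0 < σ) (hsing : A * Aᵀ * A = (σ ^ 2) • A)
    (b : Fin m → ℝ) (hb : b ∈ Set.range A.mulVec)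
    (x0 xs : Fin n → ℝ) (hxs : A.mulVec xs = b) (hx0 : x0 - xs ∈ Set.range (Aᵀ.mulVec))
    (k : ℕ) (hk : 1 ≤ k) :
    ∑ s : Fin k → Fin m,
        (∏ t, rowNorm2 A (s t) / frob2 A) *
          sqnorm ((List.ofFn s).foldl (fun x i => kacStep A b i x) x0 - xs)
      = (1 - σ ^ 2 / frob2 A) ^ k * sqnorm (x0 - xs) := by
  clear hk
  induction k generalizing x0 with
  | zero => simp
  | succ k ih =>
    rw [← (Fin.consEquiv fun _ => Fin m).sum_comp, Fintype.sum_prod_type]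
    simp only [Fin.consEquiv_apply, Fin.prod_univ_succ, Fin.cons_zero, Fin.cons_succ,
      List.ofFn_succ, List.foldl_cons, mul_assoc, ← Finset.mul_sum]
    simp_rw [ih _ (kacStep_sub_mem_range_transpose A b _ hx0),
      mul_left_comm _ ((1 - σ ^ 2 / frob2 A) ^ k)]
    rw [← Finset.mul_sum, sum_sqnorm_kacStep_sub hA hrows hxs,
      sqnorm_mulVec_of_mem_range_transpose hsing hx0]
    ring
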